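/- arXiv:1011.0395 — 2 statements merged into one kernel-verified Lean document; each statement's English description precedes it below -/
import Mathlib

section
/- Let π and σ be the permutations of {1,…,6} determined by the bottom-line words (π⁻¹(1),…,π⁻¹(6)) = (6,5,4,3,2,1) and (σ⁻¹(1),…,σ⁻¹(6)) = (4,3,6,5,2,1). Both are irreducible and their extended Rauzy classes are distinct: σ ∉ R_ex(π). (These two extended Rauzy classes correspond to the hyperelliptic and odd-spin connected components of the stratum H(4).) -/
/-- The auxiliary permutation `q m` of `Fin n` (`0`-indexed version of the
renumbering used in the Rauzy operations): it fixes every `j ≤ m`, sends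
`j ↦ j + 1` for `m < j < n - 1`, and sends the last index `n - 1` to `m + 1`.
(When `m = n - 1` it is the identity.) -/
def rauzyQ {n : ℕ} (m : Fin n) : Equiv.Perm (Fin n) :=
  (Fin.revPerm * Fin.cycleRange ⟨n - 2 - m.val, by have := m.isLt; omega⟩ * Fin.revPerm)⁻¹

/-- Rauzy operation `a`: in the two-line representation of `π` (top line
`(0, …, n-1)`, bottom line `(π⁻¹ 0, …, π⁻¹ (n-1))`) one deletes the last entry
of the bottom line and reinserts it immediately to the right of the entry
`n - 1` of the bottom line.  In terms of permutations this is
`a(π) = q (π (n-1)) ∘ π`. -/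
def rauzyA {n : ℕ} (π : Equiv.Perm (Fin n)) : Equiv.Perm (Fin n) :=
  if h : n = 0 then π else rauzyQ (π ⟨n - 1, by omega⟩) * π

/-- Rauzy operation `b`: one deletes the last entry `n - 1` of the top line,
reinserts it immediately to the right of the entry `π⁻¹ (n-1)` of the top line
and relabels the symbols in the order of their appearance in the new top line.
In terms of permutations the relabelling map is `r = q (π⁻¹ (n-1))` and
`b(π) = π ∘ r⁻¹`. -/
def rauzyB {n : ℕ} (π : Equiv.Perm (Fin n)) : Equiv.Perm (Fin n) :=
  if h : n = 0 then π else π * (rauzyQ (π⁻¹ ⟨n - 1, by omega⟩))⁻¹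

/-- Operation `c`: reverse the order of the entries in each line, interchange
the two lines and relabel so that the top line is again `(0, …, n-1)`.
In terms of permutations, `c(π) = w ∘ π⁻¹ ∘ w` where `w : j ↦ n - 1 - j`. -/
def rauzyC {n : ℕ} (π : Equiv.Perm (Fin n)) : Equiv.Perm (Fin n) :=
  Fin.revPerm * π⁻¹ * Fin.revPerm

/-- A permutation of `{0, …, n-1}` is irreducible if it maps no proper initial
segment `{0, …, k}` (with `k < n - 1`) to itself. -/
def IrreduciblePerm {n : ℕ} (π : Equiv.Perm (Fin n)) : Prop :=
  ∀ k : ℕ, k + 1 < n → ¬ (∀ i : Fin n, i.val ≤ k → (π i).val ≤ k)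

/-- The Rauzy class of `π`: the smallest set of permutations containing `π`
and closed under the Rauzy operations `a` and `b`. -/
def RauzyClass {n : ℕ} (π : Equiv.Perm (Fin n)) : Set (Equiv.Perm (Fin n)) :=
  {σ | ∀ S : Set (Equiv.Perm (Fin n)), π ∈ S →
    (∀ τ ∈ S, rauzyA τ ∈ S) → (∀ τ ∈ S, rauzyB τ ∈ S) → σ ∈ S}

/-- The extended Rauzy class of `π`: the smallest set of permutations
containing `π` and closed under the operations `a`, `b` and `c`. -/
def RauzyClassEx {n : ℕ} (π : Equiv.Perm (Fin n)) : Set (Equiv.Perm (Fin n)) :=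
  {σ | ∀ S : Set (Equiv.Perm (Fin n)), π ∈ S →
    (∀ τ ∈ S, rauzyA τ ∈ S) → (∀ τ ∈ S, rauzyB τ ∈ S) →
    (∀ τ ∈ S, rauzyC τ ∈ S) → σ ∈ S}

/-- The list of values of a permutation of `Fin 6`. -/
def permWord (τ : Equiv.Perm (Fin 6)) : List ℕ :=
  List.ofFn fun i => (τ i).val

/-- The lists of values of a permutation of `Fin 6` and of its inverse. -/
def permWords (τ : Equiv.Perm (Fin 6)) : List ℕ × List ℕ :=
  (permWord τ, permWord τ⁻¹)

/-- The action of `rauzyQ m` on indices, for `n = 6`. -/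
def rauzyQWord (m j : ℕ) : ℕ :=
  if j ≤ m then j else if j < 5 then j + 1 else m + 1

/-- The action of `(rauzyQ m)⁻¹` on indices, for `n = 6`. -/
def rauzyQInvWord (m j : ℕ) : ℕ :=
  if j ≤ m then j else if j = m + 1 then 5 else j - 1

/-- Rauzy operation `a` on pairs of words. -/
def rauzyAWords (p : List ℕ × List ℕ) : List ℕ × List ℕ :=
  (List.ofFn fun i : Fin 6 => rauzyQWord (p.1.getD 5 0) (p.1.getD i 0),
   List.ofFn fun i : Fin 6 => p.2.getD (rauzyQInvWord (p.1.getD 5 0) i) 0)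

/-- Operation `c` on pairs of words. -/
def rauzyCWords (p : List ℕ × List ℕ) : List ℕ × List ℕ :=
  (List.ofFn fun i : Fin 6 => 5 - p.2.getD (5 - i) 0,
   List.ofFn fun i : Fin 6 => 5 - p.1.getD (5 - i) 0)

theorem permWord_getD (τ : Equiv.Perm (Fin 6)) (i : Fin 6) :
    (permWord τ).getD i 0 = (τ i).val := by
  fin_cases i <;> rfl

theorem rauzyQ_val (m j : Fin 6) : (rauzyQ m j).val = rauzyQWord m j := by
  revert m j
  decide +kernel

theorem rauzyQ_inv_val (m j : Fin 6) : ((rauzyQ m)⁻¹ j).val = rauzyQInvWord m j := by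
  revert m j
  decide +kernel

theorem permWords_rauzyA (τ : Equiv.Perm (Fin 6)) :
    permWords (rauzyA τ) = rauzyAWords (permWords τ) := by
  have h5 : (permWord τ).getD 5 0 = (τ 5).val := permWord_getD τ 5
  have hA : rauzyA τ = rauzyQ (τ 5) * τ := rfl
  simp only [permWords, rauzyAWords, hA, h5, permWord_getD, ← rauzyQ_inv_val, ← rauzyQ_val]
  simp only [permWord, mul_inv_rev, Equiv.Perm.mul_apply]

theorem rauzyB_eq_inv_rauzyA_inv (τ : Equiv.Perm (Fin 6)) :
    rauzyB τ = (rauzyA τ⁻¹)⁻¹ := by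
  simp [rauzyA, rauzyB]

theorem permWords_rauzyB (τ : Equiv.Perm (Fin 6)) :
    permWords (rauzyB τ) = (rauzyAWords (permWords τ).swap).swap := by
  rw [rauzyB_eq_inv_rauzyA_inv]
  have h := permWords_rauzyA τ⁻¹
  simp only [permWords, inv_inv, Prod.swap_prod_mk] at h ⊢
  rw [← h, Prod.swap_prod_mk]

theorem permWords_rauzyC (τ : Equiv.Perm (Fin 6)) :
    permWords (rauzyC τ) = rauzyCWords (permWords τ) := by
  have hrev (i : Fin 6) : 5 - i.val = (Fin.revPerm i).val := by
    simp only [Fin.revPerm_apply, Fin.val_rev]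
    omega
  have hinv : (Fin.revPerm : Equiv.Perm (Fin 6))⁻¹ = Fin.revPerm := rfl
  simp only [permWords, rauzyCWords, rauzyC, hrev, permWord_getD]
  simp only [permWord, mul_inv_rev, inv_inv, hinv, Equiv.Perm.mul_apply]

/-- The words of the elements, paired with the words of their inverses, of the extended Rauzy
class of the order-reversing permutation of `Fin 6`. -/
def hyperellipticWords : List (List ℕ × List ℕ) :=
  [([5, 4, 3, 2, 1, 0], [5, 4, 3, 2, 1, 0]),
   ([1, 5, 4, 3, 2, 0], [5, 0, 4, 3, 2, 1]),
   ([5, 0, 4, 3, 2, 1], [1, 5, 4, 3, 2, 0]),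
   ([2, 1, 5, 4, 3, 0], [5, 1, 0, 4, 3, 2]),
   ([1, 5, 0, 4, 3, 2], [2, 0, 5, 4, 3, 1]),
   ([4, 3, 2, 1, 5, 0], [5, 3, 2, 1, 0, 4]),
   ([2, 0, 5, 4, 3, 1], [1, 5, 0, 4, 3, 2]),
   ([5, 1, 0, 4, 3, 2], [2, 1, 5, 4, 3, 0]),
   ([5, 3, 2, 1, 0, 4], [4, 3, 2, 1, 5, 0]),
   ([3, 2, 1, 5, 4, 0], [5, 2, 1, 0, 4, 3]),
   ([2, 1, 5, 0, 4, 3], [3, 1, 0, 5, 4, 2]),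
   ([1, 3, 0, 5, 4, 2], [2, 0, 5, 1, 4, 3]),
   ([1, 5, 2, 0, 4, 3], [3, 0, 2, 5, 4, 1]),
   ([4, 2, 1, 0, 5, 3], [3, 2, 1, 5, 0, 4]),
   ([3, 0, 2, 5, 4, 1], [1, 5, 2, 0, 4, 3]),
   ([2, 0, 5, 1, 4, 3], [1, 3, 0, 5, 4, 2]),
   ([3, 2, 1, 5, 0, 4], [4, 2, 1, 0, 5, 3]),
   ([3, 1, 0, 5, 4, 2], [2, 1, 5, 0, 4, 3]),
   ([5, 2, 1, 0, 4, 3], [3, 2, 1, 5, 4, 0]),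
   ([2, 1, 4, 0, 5, 3], [3, 1, 0, 5, 2, 4]),
   ([2, 1, 5, 3, 0, 4], [4, 1, 0, 3, 5, 2]),
   ([1, 4, 0, 3, 5, 2], [2, 0, 5, 3, 1, 4]),
   ([1, 3, 0, 5, 2, 4], [2, 0, 4, 1, 5, 3]),
   ([1, 4, 2, 0, 5, 3], [3, 0, 2, 5, 1, 4]),
   ([1, 5, 3, 2, 0, 4], [4, 0, 3, 2, 5, 1]),
   ([4, 1, 0, 3, 5, 2], [2, 1, 5, 3, 0, 4]),
   ([4, 0, 3, 2, 5, 1], [1, 5, 3, 2, 0, 4]),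
   ([3, 0, 2, 5, 1, 4], [1, 4, 2, 0, 5, 3]),
   ([2, 0, 4, 1, 5, 3], [1, 3, 0, 5, 2, 4]),
   ([2, 0, 5, 3, 1, 4], [1, 4, 0, 3, 5, 2]),
   ([3, 1, 0, 5, 2, 4], [2, 1, 4, 0, 5, 3])]

theorem hyperellipticWords_closed : ∀ p ∈ hyperellipticWords,
    rauzyAWords p ∈ hyperellipticWords ∧ (rauzyAWords p.swap).swap ∈ hyperellipticWords ∧
      rauzyCWords p ∈ hyperellipticWords := by
  decide +kernel

/-- The permutations of `{1, …, 6}` with bottom lines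
`(6,5,4,3,2,1)` and `(4,3,6,5,2,1)` are irreducible and lie in distinct
extended Rauzy classes (hyperelliptic and odd-spin components of `H(4)`). -/
theorem rauzyClassEx_H4_distinct (π σ : Equiv.Perm (Fin 6))
    (hπ : ∀ i, π⁻¹ i = ![5,4,3,2,1,0] i)
    (hσ : ∀ i, σ⁻¹ i = ![3,2,5,4,1,0] i) :
    IrreduciblePerm π ∧ IrreduciblePerm σ ∧ σ ∉ RauzyClassEx π := by
  have eq_of_inv (ρ τ : Equiv.Perm (Fin 6)) (h : ∀ i, ρ⁻¹ i = τ⁻¹ i) : ρ = τ :=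
    inv_injective (Equiv.ext h)
  have hπ' : π = ⟨![5, 4, 3, 2, 1, 0], ![5, 4, 3, 2, 1, 0], by decide, by decide⟩ :=
    eq_of_inv _ _ hπ
  have hσ' : σ = ⟨![5, 4, 1, 0, 3, 2], ![3, 2, 5, 4, 1, 0], by decide, by decide⟩ :=
    eq_of_inv _ _ hσ
  subst hπ' hσ'
  refine ⟨fun k hk h => ?_, fun k hk h => ?_, fun h => ?_⟩
  · have hk' : k < 5 := by omega
    revert h
    interval_cases k <;> decide
  · have hk' : k < 5 := by omega
    revert h
    interval_cases k <;> decide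
  · refine absurd (h {τ | permWords τ ∈ hyperellipticWords} ?_ ?_ ?_ ?_) ?_
    · change permWords _ ∈ hyperellipticWords
      decide +kernel
    · intro τ hτ
      rw [Set.mem_ofPred_eq, permWords_rauzyA]
      exact (hyperellipticWords_closed _ hτ).1
    · intro τ hτ
      rw [Set.mem_ofPred_eq, permWords_rauzyB]
      exact (hyperellipticWords_closed _ hτ).2.1
    · intro τ hτ
      rw [Set.mem_ofPred_eq, permWords_rauzyC]
      exact (hyperellipticWords_closed _ hτ).2.2
    · change ¬ permWords _ ∈ hyperellipticWords
      decide +kernel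
end

section
/- Let π₁, π₂, π₃ be the permutations of {1,…,8} determined by the bottom-line words (8,7,6,5,4,3,2,1), (6,5,4,3,8,7,2,1) and (4,3,6,5,8,7,2,1) respectively. All three are irreducible and their extended Rauzy classes are pairwise distinct. (These three extended Rauzy classes correspond to the hyperelliptic, even-spin and odd-spin connected components of the stratum H(6).) -/
section Transvection

variable {V : Type*}

/-- `G'` arises from `G` by replacing the basis vector of `b` by the sum of those of `a` and `b`,
where adjacency is read as an alternating form over the field with two elements. -/
structure IsTransvection (G G' : SimpleGraph V) (a b : V) : Prop where
  adj : G.Adj a b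
  adj_of_ne : ∀ i j, i ≠ b → j ≠ b → (G'.Adj i j ↔ G.Adj i j)
  adj_iff : ∀ j, j ≠ b → (G'.Adj b j ↔ Xor (G.Adj b j) (G.Adj a j))

/-- A graph property that is stable under relabelling and under transvections. -/
structure IsTransvectionInvariant (P : SimpleGraph V → Prop) : Prop where
  comap : ∀ (G : SimpleGraph V) (e : Equiv.Perm V), P G → P (G.comap e)
  transvection : ∀ (G G' : SimpleGraph V) (a b : V), IsTransvection G G' a b → P G → P G'

end Transvection

section PermGraph

variable {n : ℕ}

/-- The inversion graph of a permutation. -/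
def permGraph (π : Equiv.Perm (Fin n)) : SimpleGraph (Fin n) where
  Adj i j := (i < j ∧ π j < π i) ∨ (j < i ∧ π i < π j)
  symm := ⟨fun _ _ h => h.symm⟩
  loopless := ⟨fun i h => by simp at h⟩

instance (π : Equiv.Perm (Fin n)) : DecidableRel (permGraph π).Adj := fun i j =>
  inferInstanceAs (Decidable ((i < j ∧ π j < π i) ∨ (j < i ∧ π i < π j)))

theorem permGraph_adj (π : Equiv.Perm (Fin n)) (i j : Fin n) :
    (permGraph π).Adj i j ↔ (i < j ∧ π j < π i) ∨ (j < i ∧ π i < π j) := Iff.rfl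

theorem permGraph_inv (π : Equiv.Perm (Fin n)) :
    permGraph π⁻¹ = (permGraph π).comap ⇑(π⁻¹) := by
  ext i j
  simp only [permGraph_adj, SimpleGraph.comap_adj, Equiv.Perm.inv_def, Equiv.apply_symm_apply]
  tauto

theorem permGraph_rauzyC (π : Equiv.Perm (Fin n)) :
    permGraph (rauzyC π) = (permGraph π).comap (π⁻¹ * Fin.revPerm : Equiv.Perm (Fin n)) := by
  ext i j
  simp only [permGraph_adj, SimpleGraph.comap_adj, rauzyC, Equiv.Perm.mul_apply,
    Equiv.Perm.inv_def, Equiv.apply_symm_apply, Fin.revPerm_apply, Fin.rev_lt_rev]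
  tauto

theorem rauzyQ_val_s6 (m j : Fin (n + 1)) :
    (rauzyQ m j).val =
      if j.val ≤ m.val then j.val else if j.val < n then j.val + 1 else m.val + 1 := by
  have hm := m.isLt
  have hj := j.isLt
  have key : ∀ k : Fin (n + 1),
      (k.val = if j.val ≤ m.val then j.val else if j.val < n then j.val + 1 else m.val + 1) →
      rauzyQ m j = k := by
    intro k hk
    rw [rauzyQ, Equiv.Perm.inv_eq_iff_eq]
    simp only [Equiv.Perm.mul_apply, Fin.revPerm_apply]
    rw [← Fin.rev_inj, Fin.rev_rev]
    rcases lt_trichotomy (Fin.rev k) ⟨n + 1 - 2 - m.val, by omega⟩ with h | h | h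
    · have h' := h
      rw [Fin.lt_def, Fin.val_rev] at h'
      rw [Fin.ext_iff, Fin.val_rev, Fin.coe_cycleRange_of_lt h, Fin.val_rev]
      simp only at h'
      split_ifs at hk <;> omega
    · have h' := h
      rw [Fin.ext_iff, Fin.val_rev] at h'
      rw [Fin.ext_iff, Fin.val_rev, Fin.cycleRange_of_eq h]
      simp only [Fin.val_zero] at h' ⊢
      split_ifs at hk <;> omega
    · have h' := h
      rw [Fin.lt_def, Fin.val_rev] at h'
      rw [Fin.ext_iff, Fin.val_rev, Fin.cycleRange_of_gt h, Fin.val_rev]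
      simp only at h'
      split_ifs at hk <;> omega
  rw [key ⟨if j.val ≤ m.val then j.val else if j.val < n then j.val + 1 else m.val + 1, by
    split_ifs <;> omega⟩ rfl]

theorem rauzyA_eq (π : Equiv.Perm (Fin (n + 1))) :
    rauzyA π = rauzyQ (π (Fin.last n)) * π := by
  rw [rauzyA, dif_neg n.succ_ne_zero]
  rfl

theorem rauzyB_eq (π : Equiv.Perm (Fin (n + 1))) :
    rauzyB π = (rauzyA π⁻¹)⁻¹ := by
  rw [rauzyB, dif_neg n.succ_ne_zero, rauzyA_eq, mul_inv_rev, inv_inv]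
  rfl

theorem rauzyA_eq_self (π : Equiv.Perm (Fin (n + 1))) (h : π (Fin.last n) = Fin.last n) :
    rauzyA π = π := by
  ext i
  rw [rauzyA_eq, h, Equiv.Perm.mul_apply, rauzyQ_val_s6, if_pos (by have := (π i).isLt; simp; omega)]

theorem isTransvection_rauzyA (π : Equiv.Perm (Fin (n + 1))) (h : π (Fin.last n) ≠ Fin.last n) :
    IsTransvection (permGraph π) (permGraph (rauzyA π)) (Fin.last n) (π⁻¹ (Fin.last n)) := by
  obtain ⟨b, hb⟩ : ∃ b, π b = Fin.last n := π.surjective _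
  have hb' : π⁻¹ (Fin.last n) = b :=
    Equiv.Perm.inv_eq_iff_eq.2 hb.symm
  rw [hb']
  have hval : ∀ i, (rauzyA π i).val = if (π i).val ≤ (π (Fin.last n)).val then (π i).val else
      if (π i).val < n then (π i).val + 1 else (π (Fin.last n)).val + 1 := fun i => by
    rw [rauzyA_eq, Equiv.Perm.mul_apply, rauzyQ_val_s6]
  have hinj : ∀ i j, i.val = j.val ↔ (π i).val = (π j).val := fun i j => by
    rw [← Fin.ext_iff, ← Fin.ext_iff, π.injective.eq_iff]
  have hbn : (π b).val = n := by rw [hb, Fin.val_last]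
  have hn : (π (Fin.last n)).val ≠ n := fun h' => h (Fin.ext h')
  refine ⟨?_, fun i j hi hj => ?_, fun j hj => ?_⟩
  · have h1 := hinj b (Fin.last n)
    simp only [permGraph_adj, Fin.lt_def, Fin.val_last] at *
    omega
  · have h1 := hinj i j
    have h2 := hinj i b
    have h3 := hinj j b
    have := hval i
    have := hval j
    rw [ne_eq, Fin.ext_iff] at hi hj
    simp only [permGraph_adj, Fin.lt_def]
    split_ifs at * <;> omega
  · have h1 := hinj j b
    have h2 := hinj j (Fin.last n)
    have h3 := hinj b (Fin.last n)
    have := hval b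
    have := hval j
    rw [ne_eq, Fin.ext_iff] at hj
    have := (π (Fin.last n)).isLt
    have := (π j).isLt
    have := b.isLt
    have := j.isLt
    rw [Fin.val_last] at h2 h3
    simp only [permGraph_adj, Fin.lt_def, xor_def, Fin.val_last]
    split_ifs at * <;> omega

theorem IsTransvectionInvariant.of_mem_rauzyClassEx {P : SimpleGraph (Fin (n + 1)) → Prop}
    (hP : IsTransvectionInvariant P) {π σ : Equiv.Perm (Fin (n + 1))}
    (hσ : σ ∈ RauzyClassEx π) (hπ : P (permGraph π)) : P (permGraph σ) := by
  have hA : ∀ τ : Equiv.Perm (Fin (n + 1)), P (permGraph τ) → P (permGraph (rauzyA τ)) := by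
    intro τ hτ
    by_cases h : τ (Fin.last n) = Fin.last n
    · rwa [rauzyA_eq_self τ h]
    · exact hP.transvection _ _ _ _ (isTransvection_rauzyA τ h) hτ
  have hI : ∀ τ : Equiv.Perm (Fin (n + 1)), P (permGraph τ) → P (permGraph τ⁻¹) := by
    intro τ hτ
    rw [permGraph_inv]
    exact hP.comap _ _ hτ
  refine hσ {τ | P (permGraph τ)} hπ hA (fun τ hτ => ?_) (fun τ hτ => ?_)
  · rw [rauzyB_eq]
    exact hI _ (hA _ (hI _ hτ))
  · rw [Set.mem_ofPred_eq, permGraph_rauzyC]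
    exact hP.comap _ _ hτ

theorem self_mem_rauzyClassEx (π : Equiv.Perm (Fin n)) : π ∈ RauzyClassEx π :=
  fun _ h _ _ _ => h

theorem IsTransvectionInvariant.rauzyClassEx_ne {P : SimpleGraph (Fin (n + 1)) → Prop}
    (hP : IsTransvectionInvariant P) {π σ : Equiv.Perm (Fin (n + 1))}
    (hπ : P (permGraph π)) (hσ : ¬ P (permGraph σ)) : RauzyClassEx π ≠ RauzyClassEx σ :=
  fun h => hσ (hP.of_mem_rauzyClassEx (h ▸ self_mem_rauzyClassEx σ) hπ)

end PermGraph

section ArfForm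

variable {V : Type*} [Fintype V] [DecidableEq V]

/-- Twice the quadratic form over the field with two elements which takes the value `1` on
every vertex and whose polarization is the adjacency form of `G`, evaluated on the sum of the
vertices in `S`. -/
def arfForm (G : SimpleGraph V) [DecidableRel G.Adj] (S : Finset V) : ZMod 4 :=
  ∑ i ∈ S, ∑ j ∈ S, if i = j then 2 else if G.Adj i j then 1 else 0

/-- The number of zeros of the quadratic form attached to `G`. -/
def arfZeros (G : SimpleGraph V) [DecidableRel G.Adj] : ℕ :=
  (Finset.univ.filter fun S : Finset V => arfForm G S = 0).card

omit [Fintype V] in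
theorem arfForm_insert (G : SimpleGraph V) [DecidableRel G.Adj] {S : Finset V} {x : V}
    (hx : x ∉ S) :
    arfForm G (insert x S) = arfForm G S + 2 + 2 * ∑ j ∈ S, if G.Adj x j then 1 else 0 := by
  have h1 : ∀ i ∈ S, i ≠ x := fun i hi h => hx (h ▸ hi)
  have e1 : (∑ j ∈ S, if x = j then (2 : ZMod 4) else if G.Adj x j then 1 else 0) =
      ∑ j ∈ S, if G.Adj x j then 1 else 0 :=
    Finset.sum_congr rfl fun j hj => if_neg (h1 j hj).symm
  have e2 : (∑ i ∈ S, if i = x then (2 : ZMod 4) else if G.Adj i x then 1 else 0) =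
      ∑ j ∈ S, if G.Adj x j then 1 else 0 :=
    Finset.sum_congr rfl fun j hj => by rw [if_neg (h1 j hj)]; simp only [G.adj_comm]
  simp only [arfForm, Finset.sum_insert hx, Finset.sum_add_distrib, e1, e2, if_true]
  ring

omit [Fintype V] in
theorem arfForm_congr (G G' : SimpleGraph V) [DecidableRel G.Adj] [DecidableRel G'.Adj]
    {S : Finset V} (h : ∀ i ∈ S, ∀ j ∈ S, (G'.Adj i j ↔ G.Adj i j)) :
    arfForm G' S = arfForm G S :=
  Finset.sum_congr rfl fun i hi => Finset.sum_congr rfl fun j hj => by simp only [h i hi j hj]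

omit [Fintype V] in
theorem IsTransvection.arfForm_eq {G G' : SimpleGraph V} [DecidableRel G.Adj]
    [DecidableRel G'.Adj] {a b : V} (h : IsTransvection G G' a b) (S : Finset V) :
    arfForm G' S = arfForm G (if b ∈ S then symmDiff S {a} else S) := by
  have hab : a ≠ b := h.adj.ne
  have h4 : (4 : ZMod 4) = 0 := by decide
  have hsum : ∀ T : Finset V, b ∉ T → (2 : ZMod 4) * (∑ j ∈ T, if G'.Adj b j then 1 else 0) =
      2 * (∑ j ∈ T, if G.Adj b j then 1 else 0) + 2 * ∑ j ∈ T, if G.Adj a j then 1 else 0 := by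
    intro T hT
    simp only [Finset.mul_sum, ← Finset.sum_add_distrib]
    refine Finset.sum_congr rfl fun j hj => ?_
    have := h.adj_iff j (fun hjb => hT (hjb ▸ hj))
    rw [xor_def] at this
    by_cases h1 : G.Adj b j <;> by_cases h2 : G.Adj a j <;> simp [this, h1, h2]
    decide
  have hsame : ∀ T : Finset V, b ∉ T → arfForm G' T = arfForm G T := fun T hT =>
    arfForm_congr G G' fun i hi j hj =>
      h.adj_of_ne i j (fun hh => hT (hh ▸ hi)) (fun hh => hT (hh ▸ hj))
  split_ifs with hb
  · obtain ⟨T, hT, rfl⟩ : ∃ T, b ∉ T ∧ S = insert b T :=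
      ⟨S.erase b, Finset.notMem_erase _ _, (Finset.insert_erase hb).symm⟩
    by_cases ha : a ∈ T
    · obtain ⟨U, hU, rfl⟩ : ∃ U, a ∉ U ∧ T = insert a U :=
        ⟨T.erase a, Finset.notMem_erase _ _, (Finset.insert_erase ha).symm⟩
      have hbU : b ∉ U := fun hh => hT (Finset.mem_insert_of_mem hh)
      have e : symmDiff (insert b (insert a U)) {a} = insert b U := by
        ext x
        simp only [Finset.mem_symmDiff, Finset.mem_insert, Finset.mem_singleton]
        clear h4
        grind
      rw [e, arfForm_insert G' hT, arfForm_insert G hbU, hsum _ hT, hsame _ hT,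
        arfForm_insert G hU, Finset.sum_insert hU, Finset.sum_insert hU, if_pos h.adj.symm,
        if_neg (G.irrefl)]
      linear_combination (1 + ∑ j ∈ U, if G.Adj a j then 1 else 0) * h4
    · have e : symmDiff (insert b T) {a} = insert a (insert b T) := by
        ext x
        simp only [Finset.mem_symmDiff, Finset.mem_insert, Finset.mem_singleton]
        clear h4
        grind
      rw [e, arfForm_insert G' hT, arfForm_insert G (by simp [hab, ha]), arfForm_insert G hT,
        hsum _ hT, hsame _ hT, Finset.sum_insert hT, if_pos h.adj]
      linear_combination (-1) * h4
  · exact hsame S hb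

theorem IsTransvection.arfZeros_eq {G G' : SimpleGraph V} [DecidableRel G.Adj]
    [DecidableRel G'.Adj] {a b : V} (h : IsTransvection G G' a b) :
    arfZeros G' = arfZeros G := by
  have hab : a ≠ b := h.adj.ne
  have hinv : Function.Involutive
      (fun S : Finset V => if b ∈ S then symmDiff S {a} else S) := by
    intro S
    by_cases hb : b ∈ S
    · have : b ∈ symmDiff S {a} := by simp [Finset.mem_symmDiff, hb, hab.symm]
      simp [hb, this]
    · simp [hb]
  refine Finset.card_bijective _ hinv.bijective fun S => ?_
  simp only [Finset.mem_filter, Finset.mem_univ, true_and, h.arfForm_eq]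

theorem arfZeros_comap (G : SimpleGraph V) (e : Equiv.Perm V) [DecidableRel G.Adj]
    [DecidableRel (G.comap e).Adj] : arfZeros (G.comap e) = arfZeros G := by
  refine Finset.card_bijective _ e.finsetCongr.bijective fun S => ?_
  rw [Finset.mem_filter, Finset.mem_filter, Equiv.finsetCongr_apply]
  simp only [Finset.mem_univ, true_and, arfForm, Finset.sum_map, Equiv.coe_toEmbedding,
    e.injective.eq_iff, SimpleGraph.comap_adj]

theorem isTransvectionInvariant_arfZeros (k : ℕ) :
    IsTransvectionInvariant fun G : SimpleGraph V => ∀ _ : DecidableRel G.Adj, arfZeros G = k where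
  comap G e h _ := by
    classical
    rw [arfZeros_comap, h]
  transvection G G' a b hT h _ := by
    classical
    rw [hT.arfZeros_eq, h]

end ArfForm

section TwoSetRepresentation

variable {V : Type*}

/-- The vertices of `G` can be represented by two-element subsets of `W` such that adjacency is
the parity of the intersection. -/
def HasTwoSetRepresentation (W : Type*) [DecidableEq W] (G : SimpleGraph V) : Prop :=
  ∃ f : V → Finset W, (∀ i, (f i).card = 2) ∧ ∀ i j, G.Adj i j ↔ Odd (f i ∩ f j).card

variable {W : Type*} [DecidableEq W]

theorem card_symmDiff_add (s t : Finset W) :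
    (symmDiff s t).card + 2 * (s ∩ t).card = s.card + t.card := by
  have h1 := Finset.card_sdiff_add_card_inter s t
  have h2 := Finset.card_sdiff_add_card_inter t s
  rw [Finset.inter_comm t s] at h2
  have h3 : (symmDiff s t).card = (s \ t).card + (t \ s).card :=
    Finset.card_union_of_disjoint disjoint_sdiff_sdiff
  omega

theorem isTransvectionInvariant_hasTwoSetRepresentation :
    IsTransvectionInvariant (HasTwoSetRepresentation W : SimpleGraph V → Prop) where
  comap G e := by
    rintro ⟨f, hf, hG⟩
    exact ⟨f ∘ e, fun i => hf _, fun i j => hG _ _⟩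
  transvection G G' a b h := by
    classical
    rintro ⟨f, hf, hG⟩
    have hab : (f b ∩ f a).card = 1 := by
      have h1 := (hG b a).1 h.adj.symm
      have h2 := Finset.card_le_card (Finset.inter_subset_left (s₁ := f b) (s₂ := f a))
      rw [hf] at h2
      rw [Nat.odd_iff] at h1
      omega
    have hg : (symmDiff (f b) (f a)).card = 2 := by
      have := card_symmDiff_add (f b) (f a)
      rw [hf, hf, hab] at this
      omega
    have hbj : ∀ j, j ≠ b → (G'.Adj b j ↔ Odd (symmDiff (f b) (f a) ∩ f j).card) := by
      intro j hj
      have := card_symmDiff_add (f b ∩ f j) (f a ∩ f j)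
      have e : symmDiff (f b) (f a) ∩ f j = symmDiff (f b ∩ f j) (f a ∩ f j) :=
        inf_symmDiff_distrib_right _ _ _
      rw [h.adj_iff j hj, hG, hG, e, xor_def]
      simp only [Nat.odd_iff]
      omega
    refine ⟨Function.update f b (symmDiff (f b) (f a)), fun i => ?_, fun i j => ?_⟩
    · by_cases hi : i = b
      · rw [hi, Function.update_self, hg]
      · rw [Function.update_of_ne hi, hf]
    · by_cases hi : i = b <;> by_cases hj : j = b
      · rw [hi, hj, Function.update_self, Finset.inter_self, hg]
        simp
      · rw [hi, Function.update_self, Function.update_of_ne hj, hbj j hj]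
      · rw [hj, Function.update_self, Function.update_of_ne hi, G'.adj_comm, hbj i hi,
          Finset.inter_comm]
      · rw [Function.update_of_ne hi, Function.update_of_ne hj, h.adj_of_ne i j hi hj, hG]

theorem odd_card_pair_inter {x y : W} (hxy : x ≠ y) (t : Finset W) :
    Odd (({x, y} : Finset W) ∩ t).card ↔ Xor (x ∈ t) (y ∈ t) := by
  by_cases hx : x ∈ t <;> by_cases hy : y ∈ t <;>
    simp [Finset.insert_inter_of_mem, Finset.insert_inter_of_notMem, hx, hy, hxy]

end TwoSetRepresentation

instance {n : ℕ} (π : Equiv.Perm (Fin n)) : Decidable (IrreduciblePerm π) :=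
  decidable_of_iff (∀ k : Fin n, k.val + 1 < n → ¬ ∀ i : Fin n, i.val ≤ k.val → (π i).val ≤ k.val)
    ⟨fun h k hk => h ⟨k, by omega⟩ hk, fun h k hk => h k hk⟩

/-- The permutation with bottom line `(8,7,6,5,4,3,2,1)`. -/
def hyperellipticPerm : Equiv.Perm (Fin 8) where
  toFun := ![7,6,5,4,3,2,1,0]
  invFun := ![7,6,5,4,3,2,1,0]
  left_inv := by decide
  right_inv := by decide

/-- The permutation with bottom line `(6,5,4,3,8,7,2,1)`. -/
def evenSpinPerm : Equiv.Perm (Fin 8) where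
  toFun := ![7,6,3,2,1,0,5,4]
  invFun := ![5,4,3,2,7,6,1,0]
  left_inv := by decide
  right_inv := by decide

/-- The permutation with bottom line `(4,3,6,5,8,7,2,1)`. -/
def oddSpinPerm : Equiv.Perm (Fin 8) where
  toFun := ![7,6,1,0,3,2,5,4]
  invFun := ![3,2,5,4,7,6,1,0]
  left_inv := by decide
  right_inv := by decide

theorem arfZeros_hyperellipticPerm : arfZeros (permGraph hyperellipticPerm) = 136 := by
  decide +kernel

theorem arfZeros_evenSpinPerm : arfZeros (permGraph evenSpinPerm) = 136 := by
  decide +kernel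

theorem arfZeros_oddSpinPerm : arfZeros (permGraph oddSpinPerm) = 120 := by
  decide +kernel

theorem hasTwoSetRepresentation_hyperellipticPerm :
    HasTwoSetRepresentation (Fin 9) (permGraph hyperellipticPerm) :=
  ⟨fun i => {0, i.succ}, by decide +kernel, by decide +kernel⟩

theorem not_hasTwoSetRepresentation_evenSpinPerm (W : Type*) [DecidableEq W] :
    ¬ HasTwoSetRepresentation W (permGraph evenSpinPerm) := by
  rintro ⟨f, hf, hG⟩
  simp only [Finset.card_eq_two] at hf
  choose x y hxy hf using hf
  have hadj : ∀ i j, (permGraph evenSpinPerm).Adj i j ↔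
      Xor (x i = x j ∨ x i = y j) (y i = x j ∨ y i = y j) := by
    intro i j
    rw [hG, hf i, odd_card_pair_inter (hxy i), hf j]
    simp only [Finset.mem_insert, Finset.mem_singleton]
  have a67 := (hadj 6 7).1 (by decide)
  have a06 := (hadj 0 6).1 (by decide)
  have a07 := (hadj 0 7).1 (by decide)
  have a16 := (hadj 1 6).1 (by decide)
  have a17 := (hadj 1 7).1 (by decide)
  have a01 := (hadj 0 1).1 (by decide)
  have a02 := (hadj 0 2).1 (by decide)
  have a12 := (hadj 1 2).1 (by decide)
  have a03 := (hadj 0 3).1 (by decide)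
  have a13 := (hadj 1 3).1 (by decide)
  have a23 := (hadj 2 3).1 (by decide)
  have n26 := mt (hadj 2 6).2 (by decide)
  have n27 := mt (hadj 2 7).2 (by decide)
  have n36 := mt (hadj 3 6).2 (by decide)
  have n37 := mt (hadj 3 7).2 (by decide)
  have h0 := hxy 0
  have h1 := hxy 1
  have h2 := hxy 2
  have h3 := hxy 3
  have h6 := hxy 6
  have h7 := hxy 7
  clear hadj hxy hG hf
  generalize x 0 = x0, y 0 = y0, x 1 = x1, y 1 = y1, x 2 = x2, y 2 = y2, x 3 = x3, y 3 = y3,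
    x 6 = x6, y 6 = y6, x 7 = x7, y 7 = y7 at *
  grind

/-- The permutations of `{1, …, 8}` with bottom lines
`(8,7,6,5,4,3,2,1)`, `(6,5,4,3,8,7,2,1)` and `(4,3,6,5,8,7,2,1)` are
irreducible and their extended Rauzy classes are pairwise distinct
(hyperelliptic, even-spin and odd-spin components of `H(6)`). -/
theorem rauzyClassEx_H6_distinct (π₁ π₂ π₃ : Equiv.Perm (Fin 8))
    (hπ₁ : ∀ i, π₁⁻¹ i = ![7,6,5,4,3,2,1,0] i)
    (hπ₂ : ∀ i, π₂⁻¹ i = ![5,4,3,2,7,6,1,0] i)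
    (hπ₃ : ∀ i, π₃⁻¹ i = ![3,2,5,4,7,6,1,0] i) :
    IrreduciblePerm π₁ ∧ IrreduciblePerm π₂ ∧ IrreduciblePerm π₃ ∧
      RauzyClassEx π₁ ≠ RauzyClassEx π₂ ∧ RauzyClassEx π₁ ≠ RauzyClassEx π₃ ∧
      RauzyClassEx π₂ ≠ RauzyClassEx π₃ := by
  obtain rfl : π₁ = hyperellipticPerm := inv_injective (Equiv.ext hπ₁)
  obtain rfl : π₂ = evenSpinPerm := inv_injective (Equiv.ext hπ₂)
  obtain rfl : π₃ = oddSpinPerm := inv_injective (Equiv.ext hπ₃)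
  have harf : ∀ {k : ℕ} {π : Equiv.Perm (Fin 8)}, arfZeros (permGraph π) = k →
      ∀ _ : DecidableRel (permGraph π).Adj, arfZeros (permGraph π) = k := fun h _ => by
    convert h
  have hodd : ¬ ∀ _ : DecidableRel (permGraph oddSpinPerm).Adj,
      arfZeros (permGraph oddSpinPerm) = 136 := fun h => by
    have := h inferInstance
    rw [arfZeros_oddSpinPerm] at this
    omega
  exact ⟨by decide +kernel, by decide +kernel, by decide +kernel,
    isTransvectionInvariant_hasTwoSetRepresentation.rauzyClassEx_ne
      hasTwoSetRepresentation_hyperellipticPerm (not_hasTwoSetRepresentation_evenSpinPerm _),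
    (isTransvectionInvariant_arfZeros 136).rauzyClassEx_ne
      (harf arfZeros_hyperellipticPerm) hodd,
    (isTransvectionInvariant_arfZeros 136).rauzyClassEx_ne (harf arfZeros_evenSpinPerm) hodd⟩
end
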